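/- Let n ≥ 2 and b ≥ 1 be integers such that (n−1−b)/2 is not a positive integer. For each integer N ≥ 1 let ζ_N = exp(πi/(N+b)) ∈ ℂ, a_N = ζ_N^n, t_N = ζ_N^{−(N+n−1)}, and let S_N = 1 + ∑_{k=1}^{N} ∏_{i=1}^{k} [(ζ_N^{N+1−i} − ζ_N^{−(N+1−i)})/(ζ_N^{i} − ζ_N^{−i})] · (a_N ζ_N^{i−2} + t_N^{−1} a_N^{−1} ζ_N^{−(i−2)}) · (t_N^{2} a_N ζ_N^{N+i−1} + t_N^{−1} a_N^{−1} ζ_N^{−(N+i−1)}). Then lim_{N→∞} (2π/(N+1)) · log|S_N| = 4∫_0^{5π/6} log(2 sin t) dt. -/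

import Mathlib

open Filter Finset

/-- The SU(n)-specialized superpolynomial of the figure-eight knot at the
root of unity `ζ_N = exp(πi/(N+b))`, via its cyclotomic expansion. -/
noncomputable def S (n b : ℤ) (N : ℕ) : ℂ :=
  let ζ : ℂ := Complex.exp (Real.pi * Complex.I / ((N : ℂ) + (b : ℂ)))
  let a : ℂ := ζ ^ n
  let t : ℂ := ζ ^ (-((N : ℤ) + n - 1))
  1 + ∑ k ∈ Finset.Icc 1 N, ∏ i ∈ Finset.Icc 1 k,
      ((ζ ^ ((N : ℤ) + 1 - (i : ℤ)) - ζ ^ (-((N : ℤ) + 1 - (i : ℤ)))) /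
          (ζ ^ (i : ℤ) - ζ ^ (-(i : ℤ)))) *
        (a * ζ ^ ((i : ℤ) - 2) + t⁻¹ * a⁻¹ * ζ ^ (-((i : ℤ) - 2))) *
        (t ^ 2 * a * ζ ^ ((N : ℤ) + (i : ℤ) - 1) +
          t⁻¹ * a⁻¹ * ζ ^ (-((N : ℤ) + (i : ℤ) - 1)))


/-- half-integer sine factor -/
noncomputable def U (M : ℕ) (h : ℤ) : ℝ := |2 * Real.sin (Real.pi * h / (2 * M))|

/-- shifted products -/
noncomputable def Q (M k : ℕ) (e : ℤ) : ℝ := ∏ i ∈ range k, U M (2 * ((i : ℤ) + 1) + e)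

/-- the real factor -/
noncomputable def g (n b : ℤ) (M : ℕ) (i : ℕ) : ℝ :=
  (2 * Real.sin (Real.pi * ((2 * (i : ℤ) + (2 * b - 2) : ℤ) : ℝ) / (2 * M))) /
    (2 * Real.sin (Real.pi * ((2 * (i : ℤ) + 0 : ℤ) : ℝ) / (2 * M))) *
  (2 * Real.sin (Real.pi * ((2 * (i : ℤ) + (b + n - 3) : ℤ) : ℝ) / (2 * M))) *
  (2 * Real.sin (Real.pi * ((2 * (i : ℤ) + (b + 1 - n) : ℤ) : ℝ) / (2 * M)))

lemma zpow_exp_eq (x : ℝ) (p : ℤ) :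
    (Complex.exp ((x : ℂ) * Complex.I)) ^ p = Real.cos (p * x) + Real.sin (p * x) * Complex.I := by
  rw [← Complex.exp_int_mul, ← mul_assoc, Complex.exp_mul_I]
  push_cast; rfl

lemma factor_eq (n b : ℤ) (N : ℕ) (hM : (0:ℝ) < (N:ℝ) + b) (M : ℕ) (hMM : (M:ℤ) = N + b) (i : ℕ) (ζ : ℂ)
    (hζ : ζ = Complex.exp (Real.pi * Complex.I / ((N : ℂ) + (b : ℂ)))) :
    ((ζ ^ ((N : ℤ) + 1 - (i : ℤ)) - ζ ^ (-((N : ℤ) + 1 - (i : ℤ)))) /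
          (ζ ^ (i : ℤ) - ζ ^ (-(i : ℤ)))) *
        (ζ ^ n * ζ ^ ((i : ℤ) - 2) + (ζ ^ (-((N : ℤ) + n - 1)))⁻¹ * (ζ ^ n)⁻¹ * ζ ^ (-((i : ℤ) - 2))) *
        ((ζ ^ (-((N : ℤ) + n - 1))) ^ 2 * ζ ^ n * ζ ^ ((N : ℤ) + (i : ℤ) - 1) +
          (ζ ^ (-((N : ℤ) + n - 1)))⁻¹ * (ζ ^ n)⁻¹ * ζ ^ (-((N : ℤ) + (i : ℤ) - 1)))
    = ((g n b M i : ℝ) : ℂ) := by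
  have hMr : (M:ℝ) = N + b := by exact_mod_cast hMM
  set θ : ℝ := Real.pi / M with hθ
  have hM0 : (M:ℝ) ≠ 0 := by rw [hMr]; exact hM.ne'
  have hz : ζ = Complex.exp ((θ:ℂ) * Complex.I) := by
    rw [hζ, hθ]; congr 1
    have : (N:ℂ) + b = (M:ℂ) := by exact_mod_cast hMr.symm
    rw [this]; push_cast; ring
  have hz0 : ζ ≠ 0 := by rw [hz]; exact Complex.exp_ne_zero _
  have hNθ : (N:ℝ) * θ = Real.pi - b * θ := by
    have : (M:ℝ) * θ = Real.pi := by rw [hθ]; field_simp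
    rw [hMr] at this; linarith
  have two : ∀ p : ℤ, ζ ^ p - ζ ^ (-p) = 2 * Complex.I * (Real.sin (p * θ) : ℂ) := by
    intro p
    rw [hz, zpow_exp_eq, zpow_exp_eq]
    push_cast
    rw [neg_mul, Complex.cos_neg, Complex.sin_neg]; ring
  have twoc : ∀ p : ℤ, ζ ^ p + ζ ^ (-p) = ((2 * Real.cos (p * θ) : ℝ) : ℂ) := by
    intro p
    rw [hz, zpow_exp_eq, zpow_exp_eq]
    push_cast
    rw [neg_mul, Complex.cos_neg, Complex.sin_neg]; ring
  have hAB : (ζ ^ n * ζ ^ ((i : ℤ) - 2) + (ζ ^ (-((N : ℤ) + n - 1)))⁻¹ * (ζ ^ n)⁻¹ * ζ ^ (-((i : ℤ) - 2))) *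
        ((ζ ^ (-((N : ℤ) + n - 1))) ^ 2 * ζ ^ n * ζ ^ ((N : ℤ) + (i : ℤ) - 1) +
          (ζ ^ (-((N : ℤ) + n - 1)))⁻¹ * (ζ ^ n)⁻¹ * ζ ^ (-((N : ℤ) + (i : ℤ) - 1)))
      = (ζ ^ ((N:ℤ) + 1 - 2 * i) + ζ ^ (-((N:ℤ) + 1 - 2 * i))) + (ζ ^ (n - 2) + ζ ^ (-(n-2))) := by
    have e2 : (ζ ^ (-((N : ℤ) + n - 1))) ^ 2 = ζ ^ (-((N : ℤ) + n - 1) * 2) := by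
      rw [zpow_mul]; norm_cast
    rw [e2, ← zpow_neg, ← zpow_neg]
    simp only [← zpow_add₀ hz0, mul_add, add_mul]
    ring_nf
  rw [mul_assoc, hAB, two, two, twoc, twoc, g]
  have s1 : Real.sin ((((N:ℤ) + 1 - (i:ℤ) : ℤ) : ℝ) * θ) =
      Real.sin (Real.pi * ((2 * (i : ℤ) + (2 * b - 2) : ℤ) : ℝ) / (2 * M)) := by
    rw [← Real.sin_pi_sub]
    congr 1
    push_cast
    have : ((N:ℝ) + 1 - i) * θ = Real.pi - b * θ + (1 - i) * θ := by rw [← hNθ]; ring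
    rw [this, hθ]; field_simp; ring
  have s2 : Real.sin (((i:ℤ) : ℝ) * θ) =
      Real.sin (Real.pi * ((2 * (i : ℤ) + 0 : ℤ) : ℝ) / (2 * M)) := by
    congr 1; push_cast; rw [hθ]; field_simp; ring
  have c1 : Real.cos ((((N:ℤ) + 1 - 2 * (i:ℤ) : ℤ) : ℝ) * θ) = - Real.cos ((2 * i + b - 1) * θ) := by
    rw [← Real.cos_pi_sub]
    rw [← Real.cos_neg]
    have : (((N:ℤ) + 1 - 2 * (i:ℤ) : ℤ) : ℝ) * θ = Real.pi - b * θ + (1 - 2 * i) * θ := by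
      rw [← hNθ]; push_cast; ring
    rw [this, ← Real.cos_neg]; congr 1; ring
  rw [c1, s1, s2]
  have key : 2 * -Real.cos ((2 * i + b - 1) * θ) + 2 * Real.cos (((n - 2 : ℤ) : ℝ) * θ) =
    (2 * Real.sin (Real.pi * ((2 * (i : ℤ) + (b + n - 3) : ℤ) : ℝ) / (2 * M))) *
    (2 * Real.sin (Real.pi * ((2 * (i : ℤ) + (b + 1 - n) : ℤ) : ℝ) / (2 * M))) := by
    have e1 : (2 * i + b - 1) * θ = Real.pi * ((2 * (i : ℤ) + (b + n - 3) : ℤ) : ℝ) / (2 * M) +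
       Real.pi * ((2 * (i : ℤ) + (b + 1 - n) : ℤ) : ℝ) / (2 * M) := by
      push_cast; rw [hθ]; field_simp; ring
    have e2 : ((n - 2 : ℤ) : ℝ) * θ = Real.pi * ((2 * (i : ℤ) + (b + n - 3) : ℤ) : ℝ) / (2 * M) -
       Real.pi * ((2 * (i : ℤ) + (b + 1 - n) : ℤ) : ℝ) / (2 * M) := by
      push_cast; rw [hθ]; field_simp; ring
    rw [e1, e2, Real.cos_add, Real.cos_sub]; ring
  rw [mul_assoc (_ / _), ← key]
  push_cast
  congr 1
  rw [mul_div_mul_left _ _ (by simp), mul_div_mul_left _ _ (by simp)]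

lemma S_eq (n b : ℤ) (N M : ℕ) (hb : 1 ≤ b) (hMM : (M:ℤ) = N + b) :
    S n b N = ((1 + ∑ k ∈ Finset.Icc 1 N, ∏ i ∈ Finset.Icc 1 k, g n b M i : ℝ) : ℂ) := by
  have hM : (0:ℝ) < (N:ℝ) + b := by
    have : (1:ℝ) ≤ b := by exact_mod_cast hb
    positivity
  unfold S
  push_cast
  congr 1
  refine Finset.sum_congr rfl fun k _ => Finset.prod_congr rfl fun i _ => ?_
  exact factor_eq n b N hM M hMM i _ rfl

lemma U_nonneg (M : ℕ) (h : ℤ) : 0 ≤ U M h := abs_nonneg _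

lemma U_le_two (M : ℕ) (h : ℤ) : U M h ≤ 2 := by
  unfold U
  rw [abs_mul, abs_two]
  have := Real.abs_sin_le_one (Real.pi * h / (2 * M))
  linarith

lemma U_period (M : ℕ) (hM : 0 < M) (h c : ℤ) : U M (h + 2 * M * c) = U M h := by
  unfold U
  have hM' : (M:ℝ) ≠ 0 := by positivity
  have : Real.pi * ((h + 2 * M * c : ℤ) : ℝ) / (2 * M) = Real.pi * h / (2 * M) + c * Real.pi := by
    push_cast; field_simp
  rw [this, Real.sin_add_int_mul_pi, abs_mul, abs_mul, abs_mul]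
  rcases Int.even_or_odd c with hc | hc
  · rw [hc.neg_one_zpow]; simp
  · rw [hc.neg_one_zpow]; simp

lemma U_range (M : ℕ) (hM : 0 < M) (h : ℤ) (h0 : 0 ≤ h) (h1 : h ≤ 2 * M) :
    U M h = 2 * Real.sin (Real.pi * h / (2 * M)) ∧ 0 ≤ Real.sin (Real.pi * h / (2 * M)) := by
  have hM' : (0:ℝ) < M := by positivity
  have h0' : (0:ℝ) ≤ h := by exact_mod_cast h0
  have h1' : (h:ℝ) ≤ 2 * M := by exact_mod_cast h1
  have : 0 ≤ Real.sin (Real.pi * h / (2 * M)) := by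
    apply Real.sin_nonneg_of_nonneg_of_le_pi (by positivity)
    rw [div_le_iff₀ (by positivity)]
    exact mul_le_mul_of_nonneg_left h1' Real.pi_pos.le
  exact ⟨abs_of_nonneg (by linarith), this⟩

lemma U_lower_aux (M : ℕ) (hM : 0 < M) (h : ℤ) (h0 : 0 < h) (h1 : h < 2 * M) : 1 / (M:ℝ) ≤ U M h := by
  obtain ⟨e, hs⟩ := U_range M hM h h0.le h1.le
  have hM' : (0:ℝ) < M := by positivity
  have h0' : (1:ℝ) ≤ h := by exact_mod_cast h0
  have h1' : (h:ℝ) + 1 ≤ 2 * M := by exact_mod_cast h1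
  have hpi := Real.pi_pos
  have : 1 / (M:ℝ) ≤ Real.sin (Real.pi * h / (2 * M)) := by
    rcases le_total (h:ℝ) M with hh | hh
    · refine le_trans ?_ (Real.mul_le_sin (by positivity) ?_)
      · rw [show 2 / Real.pi * (Real.pi * h / (2 * M)) = h / (M:ℝ) by field_simp]
        gcongr
      · rw [div_le_div_iff₀ (by positivity) (by positivity)]; nlinarith
    · rw [← Real.sin_pi_sub, show Real.pi - Real.pi * h / (2 * M) = Real.pi * (2 * M - h) / (2 * M) by field_simp]
      refine le_trans ?_ (Real.mul_le_sin ?_ ?_)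
      · rw [show 2 / Real.pi * (Real.pi * (2 * M - h) / (2 * M)) = (2 * M - h) / (M:ℝ) by field_simp]
        gcongr; linarith
      · apply div_nonneg (mul_nonneg hpi.le (by linarith)) (by positivity)
      · rw [div_le_div_iff₀ (by positivity) (by positivity)]; nlinarith
  rw [e]; linarith

lemma U_lower (M : ℕ) (hM : 0 < M) (h : ℤ) (hd : ¬ (2 * M : ℤ) ∣ h) : 1 / (M:ℝ) ≤ U M h := by
  have e := Int.emod_add_mul_ediv h (2 * M)
  rw [← e, U_period M hM]
  have hM2 : (0:ℤ) < 2 * M := by positivity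
  have a := Int.emod_nonneg h hM2.ne'
  have a2 : h % (2 * M) ≠ 0 := fun hh => hd (Int.dvd_of_emod_eq_zero hh)
  exact U_lower_aux M hM _ (by omega) (Int.emod_lt_of_pos h hM2)

lemma U_logconcave (M : ℕ) (hM : 0 < M) (h : ℤ) (h0 : 1 ≤ h) (h1 : h + 1 ≤ 2 * M) :
    U M (h - 1) * U M (h + 1) ≤ U M h * U M h := by
  rw [(U_range M hM h (by omega) (by omega)).1, (U_range M hM (h-1) (by omega) (by omega)).1,
    (U_range M hM (h+1) (by omega) (by omega)).1]
  have e1 : Real.pi * ((h - 1 : ℤ) : ℝ) / (2 * M) = Real.pi * h / (2 * M) - Real.pi / (2 * M) := by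
    push_cast; ring
  have e2 : Real.pi * ((h + 1 : ℤ) : ℝ) / (2 * M) = Real.pi * h / (2 * M) + Real.pi / (2 * M) := by
    push_cast; ring
  rw [e1, e2, Real.sin_add, Real.sin_sub]
  set x := Real.pi * h / (2 * M)
  set y := Real.pi / (2 * M)
  have := Real.sin_sq_add_cos_sq x
  have := Real.sin_sq_add_cos_sq y
  have e : 2 * (Real.sin x * Real.cos y - Real.cos x * Real.sin y) * (2 * (Real.sin x * Real.cos y + Real.cos x * Real.sin y))
    = 4 * (Real.sin x ^ 2 * Real.cos y ^ 2 - Real.cos x ^ 2 * Real.sin y ^ 2) := by ring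
  rw [e, Real.cos_sq', Real.cos_sq']
  nlinarith [sq_nonneg (Real.sin y)]

lemma U_ge_one (M : ℕ) (hM : 0 < M) (i : ℕ) (h0 : M ≤ 6 * i) (h1 : 6 * i ≤ 5 * M) : 1 ≤ U M (2 * i) := by
  rw [(U_range M hM (2 * i) (by omega) (by omega)).1]
  have hM' : (0:ℝ) < M := by positivity
  have h0' : (M:ℝ) ≤ 6 * i := by exact_mod_cast h0
  have h1' : 6 * (i:ℝ) ≤ 5 * M := by exact_mod_cast h1
  have hpi := Real.pi_pos
  have e : Real.pi * ((2 * i : ℤ) : ℝ) / (2 * M) = Real.pi * i / M := by push_cast; field_simp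
  rw [e]
  have : Real.sin (Real.pi / 6) ≤ Real.sin (Real.pi * i / M) := by
    have a : Real.pi / 6 ≤ Real.pi * i / M := by
      rw [div_le_div_iff₀ (by positivity) hM']; nlinarith
    rcases le_total (Real.pi * i / M) (Real.pi / 2) with hh | hh
    · exact Real.sin_le_sin_of_le_of_le_pi_div_two (by linarith) hh a
    · rw [← Real.sin_pi_sub (Real.pi * i / M)]
      apply Real.sin_le_sin_of_le_of_le_pi_div_two (by linarith) (by linarith)
      have : Real.pi * i / M ≤ 5 * Real.pi / 6 := by
        rw [div_le_div_iff₀ hM' (by positivity)]; nlinarith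
      linarith
  rw [Real.sin_pi_div_six] at this
  linarith

lemma U_le_one (M : ℕ) (hM : 0 < M) (i : ℕ) (h : 6 * i ≤ M ∨ (5 * M ≤ 6 * i ∧ i ≤ M)) : U M (2 * i) ≤ 1 := by
  rw [(U_range M hM (2 * i) (by omega) (by omega)).1]
  have hM' : (0:ℝ) < M := by positivity
  have hpi := Real.pi_pos
  have e : Real.pi * ((2 * i : ℤ) : ℝ) / (2 * M) = Real.pi * i / M := by push_cast; field_simp
  rw [e]
  have : Real.sin (Real.pi * i / M) ≤ Real.sin (Real.pi / 6) := by
    rcases h with h | ⟨h, h2⟩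
    · have h' : 6 * (i:ℝ) ≤ M := by exact_mod_cast h
      have a0 : 0 ≤ Real.pi * i / M := by positivity
      apply Real.sin_le_sin_of_le_of_le_pi_div_two (by linarith) (by linarith)
      rw [div_le_div_iff₀ hM' (by positivity)]; nlinarith
    · have h' : 5 * (M:ℝ) ≤ 6 * i := by exact_mod_cast h
      have h2' : (i:ℝ) ≤ M := by exact_mod_cast h2
      have a : 5 * Real.pi / 6 ≤ Real.pi * i / M := by
        rw [div_le_div_iff₀ (by positivity) hM']; nlinarith
      have a2 : Real.pi * i / M ≤ Real.pi := by
        rw [div_le_iff₀ hM']; nlinarith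
      rw [← Real.sin_pi_sub (Real.pi * i / M)]
      apply Real.sin_le_sin_of_le_of_le_pi_div_two (by linarith) (by linarith)
      linarith
  rw [Real.sin_pi_div_six] at this
  linarith

lemma Q_nonneg (M k : ℕ) (e : ℤ) : 0 ≤ Q M k e := Finset.prod_nonneg fun _ _ => U_nonneg _ _

lemma Q_le (M k : ℕ) (e : ℤ) : Q M k e ≤ 2 ^ k := by
  unfold Q
  calc _ ≤ ∏ i ∈ range k, (2:ℝ) := Finset.prod_le_prod (fun _ _ => U_nonneg _ _) fun _ _ => U_le_two _ _
    _ = _ := by simp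

lemma Q_ge (M k : ℕ) (hM : 0 < M) (e : ℤ) (h : ∀ i < k, ¬ (2 * M : ℤ) ∣ (2 * ((i : ℤ) + 1) + e)) :
    (1 / (M:ℝ)) ^ k ≤ Q M k e := by
  unfold Q
  calc _ = ∏ i ∈ range k, (1 / (M:ℝ)) := by simp
    _ ≤ _ := Finset.prod_le_prod (fun _ _ => by positivity) fun i hi =>
      U_lower M hM _ (h i (Finset.mem_range.1 hi))

lemma Q_add (M k d : ℕ) (e : ℤ) : Q M (k + d) e = Q M k e * Q M d (e + 2 * k) := by
  unfold Q
  rw [Finset.prod_range_add]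
  congr 1
  refine Finset.prod_congr rfl fun i _ => ?_
  congr 1; push_cast; ring

lemma Q_shift (M k d : ℕ) (e : ℤ) : Q M k (e + 2 * d) * Q M d e = Q M k e * Q M d (e + 2 * k) := by
  rw [← Q_add, mul_comm, ← Q_add, add_comm]

lemma shift_up (M k d : ℕ) (hM : 0 < M) (e : ℤ) (h : ∀ i < d, ¬ (2 * M : ℤ) ∣ (2 * ((i : ℤ) + 1) + e)) :
    Q M k (e + 2 * d) ≤ (2 * M) ^ d * Q M k e := by
  have h1 := Q_ge M d hM e h
  have h2 := Q_le M d (e + 2 * k)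
  have h3 := Q_shift M k d e
  have hM' : (0:ℝ) < M := by positivity
  have : Q M k (e + 2 * d) * (1 / (M:ℝ)) ^ d ≤ Q M k e * 2 ^ d := by
    calc _ ≤ Q M k (e + 2 * d) * Q M d e := mul_le_mul_of_nonneg_left h1 (Q_nonneg _ _ _)
      _ = _ := h3
      _ ≤ _ := mul_le_mul_of_nonneg_left h2 (Q_nonneg _ _ _)
  rw [one_div, inv_pow, ← div_eq_mul_inv, div_le_iff₀ (by positivity)] at this
  rw [mul_pow]; linarith

lemma shift_down (M k d : ℕ) (hM : 0 < M) (e : ℤ)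
    (h : ∀ i < d, ¬ (2 * M : ℤ) ∣ (2 * ((i : ℤ) + 1) + (e + 2 * k))) :
    Q M k e ≤ (2 * M) ^ d * Q M k (e + 2 * d) := by
  have h1 := Q_ge M d hM _ h
  have h2 := Q_le M d e
  have h3 := Q_shift M k d e
  have hM' : (0:ℝ) < M := by positivity
  have : Q M k e * (1 / (M:ℝ)) ^ d ≤ Q M k (e + 2 * d) * 2 ^ d := by
    calc _ ≤ Q M k e * Q M d (e + 2 * k) := mul_le_mul_of_nonneg_left h1 (Q_nonneg _ _ _)
      _ = _ := h3.symm
      _ ≤ _ := mul_le_mul_of_nonneg_left h2 (Q_nonneg _ _ _)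
  rw [one_div, inv_pow, ← div_eq_mul_inv, div_le_iff₀ (by positivity)] at this
  rw [mul_pow]; linarith

lemma odd_ndvd (M : ℕ) (x : ℤ) (hx : Odd x) : ¬ (2 * M : ℤ) ∣ x := by
  intro h
  have : (2:ℤ) ∣ x := (Dvd.intro _ rfl).trans h
  obtain ⟨c, hc⟩ := hx
  omega

lemma range_ndvd (M : ℕ) (x : ℤ) (h0 : 0 < x) (h1 : x < 2 * M) : ¬ (2 * M : ℤ) ∣ x := by
  intro h
  have := Int.le_of_dvd h0 h
  omega

lemma half_up (M k : ℕ) (hk : k < M) : Q M k 1 ≤ (2 * M) * Q M k 0 := by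
  have hM : 0 < M := by omega
  have hM' : (1:ℝ) ≤ M := by exact_mod_cast hM
  have h1 : Q M k (-1) * Q M k 1 ≤ Q M k 0 * Q M k 0 := by
    unfold Q
    rw [← Finset.prod_mul_distrib, ← Finset.prod_mul_distrib]
    refine Finset.prod_le_prod (fun _ _ => mul_nonneg (U_nonneg _ _) (U_nonneg _ _)) fun i hi => ?_
    have := Finset.mem_range.1 hi
    have := U_logconcave M hM (2 * ((i:ℤ) + 1)) (by omega) (by omega)
    simpa [sub_eq_add_neg] using this
  have h2 := shift_up M k 1 hM (-1) (fun i hi => odd_ndvd _ _ ⟨i, by ring⟩)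
  norm_num at h2
  have p1 := Q_nonneg M k 1
  have p0 := Q_nonneg M k 0
  have : Q M k 1 * Q M k 1 ≤ (2 * M) * (Q M k 0 * Q M k 0) := by
    calc _ ≤ (2 * M * Q M k (-1)) * Q M k 1 := mul_le_mul_of_nonneg_right h2 p1
      _ = 2 * M * (Q M k (-1) * Q M k 1) := by ring
      _ ≤ _ := by gcongr
  apply abs_le_of_sq_le_sq' _ (by positivity) |>.2
  calc Q M k 1 ^ 2 ≤ (2 * M) * (Q M k 0 * Q M k 0) := by rw [sq]; exact this
    _ ≤ (2 * M) * (2 * M) * (Q M k 0 * Q M k 0) := by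
      have : (2 * M : ℝ) ≤ (2 * M) * (2 * M) := by nlinarith
      exact mul_le_mul_of_nonneg_right this (by positivity)
    _ = _ := by ring

lemma half_down (M k : ℕ) (hk : k + 1 < M) : Q M k 0 ≤ (2 * M) * Q M k 1 := by
  have hM : 0 < M := by omega
  have hM' : (1:ℝ) ≤ M := by exact_mod_cast hM
  have h1 : Q M k 0 * Q M k 2 ≤ Q M k 1 * Q M k 1 := by
    unfold Q
    rw [← Finset.prod_mul_distrib, ← Finset.prod_mul_distrib]
    refine Finset.prod_le_prod (fun _ _ => mul_nonneg (U_nonneg _ _) (U_nonneg _ _)) fun i hi => ?_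
    have := Finset.mem_range.1 hi
    have := U_logconcave M hM (2 * ((i:ℤ) + 1) + 1) (by omega) (by omega)
    rw [show 2 * ((i:ℤ) + 1) + 2 = 2 * ((i:ℤ) + 1) + 1 + 1 by ring]
    rw [show 2 * ((i:ℤ) + 1) + 1 - 1 = 2 * ((i:ℤ) + 1) + 0 by ring] at this
    exact this
  have h2 := shift_down M k 1 hM 0 (fun i hi => range_ndvd _ _ (by omega) (by omega))
  norm_num at h2
  have p1 := Q_nonneg M k 1
  have p0 := Q_nonneg M k 0
  have : Q M k 0 * Q M k 0 ≤ (2 * M) * (Q M k 1 * Q M k 1) := by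
    calc _ ≤ Q M k 0 * (2 * M * Q M k 2) := mul_le_mul_of_nonneg_left h2 p0
      _ = 2 * M * (Q M k 0 * Q M k 2) := by ring
      _ ≤ _ := by gcongr
  apply abs_le_of_sq_le_sq' _ (by positivity) |>.2
  calc Q M k 0 ^ 2 ≤ (2 * M) * (Q M k 1 * Q M k 1) := by rw [sq]; exact this
    _ ≤ (2 * M) * (2 * M) * (Q M k 1 * Q M k 1) := by
      have : (2 * M : ℝ) ≤ (2 * M) * (2 * M) := by nlinarith
      exact mul_le_mul_of_nonneg_right this (by positivity)
    _ = _ := by ring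

/-- upper comparison -/
lemma cmp_up (e : ℤ) (he : Odd e ∨ 0 ≤ e) : ∃ C M0 : ℕ, ∀ M ≥ M0, ∀ k < M,
    Q M k e ≤ (2 * M) ^ C * Q M k 0 := by
  rcases Int.even_or_odd' e with ⟨d, rfl | rfl⟩
  · have hd : 0 ≤ d := by
      rcases he with h | h
      · obtain ⟨c, hc⟩ := h; omega
      · omega
    lift d to ℕ using hd
    refine ⟨d, d + 1, fun M hM k hk => ?_⟩
    simpa using shift_up M k d (by omega) 0 (fun i hi => range_ndvd _ _ (by omega) (by omega))
  · rcases le_total 0 d with hd | hd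
    · lift d to ℕ using hd
      refine ⟨d + 1, 0, fun M hM k hk => ?_⟩
      have := shift_up M k d (by omega) 1 (fun i hi => odd_ndvd _ _ ⟨i + 1, by ring⟩)
      rw [add_comm]
      calc _ ≤ _ := this
        _ ≤ (2 * M) ^ d * ((2 * M) * Q M k 0) := by gcongr; exact half_up M k hk
        _ = _ := by ring
    · obtain ⟨c, hc⟩ := Int.eq_ofNat_of_zero_le (neg_nonneg.2 hd)
      refine ⟨c + 1, 0, fun M hM k hk => ?_⟩
      have := shift_down M k c (by omega) (2 * d + 1) (fun i hi => odd_ndvd _ _ ⟨i + 1 + d + k, by ring⟩)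
      rw [show 2 * d + 1 + 2 * (c:ℤ) = 1 by omega] at this
      calc _ ≤ _ := this
        _ ≤ (2 * M) ^ c * ((2 * M) * Q M k 0) := by gcongr; exact half_up M k hk
        _ = _ := by ring

/-- lower comparison at the peak -/
lemma cmp_down (e : ℤ) (he : Odd e ∨ 0 ≤ e) : ∃ C M0 : ℕ, ∀ M ≥ M0,
    Q M (5 * M / 6) 0 ≤ (2 * M) ^ C * Q M (5 * M / 6) e := by
  rcases Int.even_or_odd' e with ⟨d, rfl | rfl⟩
  · have hd : 0 ≤ d := by
      rcases he with h | h
      · obtain ⟨c, hc⟩ := h; omega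
      · omega
    lift d to ℕ using hd
    refine ⟨d, 6 * (d + 1), fun M hM => ?_⟩
    simpa using shift_down M (5 * M / 6) d (by omega) 0 (fun i hi => range_ndvd _ _ (by omega) (by omega))
  · rcases le_total 0 d with hd | hd
    · lift d to ℕ using hd
      refine ⟨d + 1, 12, fun M hM => ?_⟩
      have := shift_down M (5 * M / 6) d (by omega) 1 (fun i hi => odd_ndvd _ _ ⟨i + 1 + (5 * M / 6 : ℕ), by ring⟩)
      rw [add_comm (2 * (d:ℤ))]
      calc _ ≤ _ := half_down M (5 * M / 6) (by omega)
        _ ≤ (2 * M) * ((2 * M) ^ d * Q M (5 * M / 6) (1 + 2 * d)) := by gcongr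
        _ = _ := by ring
    · obtain ⟨c, hc⟩ := Int.eq_ofNat_of_zero_le (neg_nonneg.2 hd)
      refine ⟨c + 1, 12, fun M hM => ?_⟩
      have := shift_up M (5 * M / 6) c (by omega) (2 * d + 1) (fun i hi => odd_ndvd _ _ ⟨i + 1 + d, by ring⟩)
      rw [show 2 * d + 1 + 2 * (c:ℤ) = 1 by omega] at this
      calc _ ≤ _ := half_down M (5 * M / 6) (by omega)
        _ ≤ (2 * M) * ((2 * M) ^ c * Q M (5 * M / 6) (2 * d + 1)) := by gcongr
        _ = _ := by ring

lemma Q_full (m : ℕ) : Q (m + 1) m 0 = m + 1 := by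
  have h := IsPrimitiveRoot.prod_one_sub_pow_eq_order (Complex.isPrimitiveRoot_exp (m + 1) (by omega))
  have h2 := congrArg norm h
  rw [norm_prod] at h2
  have : ‖((m:ℂ) + 1)‖ = m + 1 := by
    rw [show ((m:ℂ) + 1) = ((m + 1 : ℕ) : ℂ) by push_cast; rfl, Complex.norm_natCast]; push_cast; rfl
  rw [this] at h2
  rw [← h2]
  unfold Q
  refine Finset.prod_congr rfl fun i _ => ?_
  rw [← Complex.exp_nat_mul]
  have e : ((i + 1 : ℕ) : ℂ) * (2 * Real.pi * Complex.I / ((m + 1 : ℕ) : ℂ)) =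
    Complex.I * ((2 * Real.pi * (i + 1) / (m + 1) : ℝ) : ℂ) := by push_cast; ring
  rw [e, norm_sub_rev, Complex.norm_exp_I_mul_ofReal_sub_one, U, Real.norm_eq_abs]
  congr 3
  push_cast; field_simp; try ring

lemma prod_ge_one_aux (M k d : ℕ) (hM : 0 < M) (h0 : M ≤ 6 * (k + 1)) (h1 : 6 * (k + d) ≤ 5 * M) :
    1 ≤ Q M d (0 + 2 * k) := by
  unfold Q
  have : ∀ i ∈ range d, 1 ≤ U M (2 * ((i:ℤ) + 1) + (0 + 2 * k)) := by
    intro i hi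
    have := Finset.mem_range.1 hi
    have := U_ge_one M hM (i + 1 + k) (by omega) (by omega)
    convert this using 2; push_cast; ring
  calc (1:ℝ) = ∏ i ∈ range d, (1:ℝ) := by simp
    _ ≤ _ := Finset.prod_le_prod (by simp) this

lemma prod_le_one_aux (M k d : ℕ) (hM : 0 < M) (h : 6 * (k + d) ≤ M ∨ (5 * M ≤ 6 * (k + 1) ∧ k + d ≤ M)) :
    Q M d (0 + 2 * k) ≤ 1 := by
  unfold Q
  refine Finset.prod_le_one (fun _ _ => U_nonneg _ _) fun i hi => ?_
  have := Finset.mem_range.1 hi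
  have := U_le_one M hM (i + 1 + k) (by omega)
  rw [show 2 * ((i:ℤ) + 1) + (0 + 2 * (k:ℤ)) = 2 * ((i + 1 + k : ℕ) : ℤ) by push_cast; ring]
  exact this

lemma peak_ge_one (M : ℕ) (hM : 0 < M) : 1 ≤ Q M (5 * M / 6) 0 := by
  obtain ⟨m, rfl⟩ : ∃ m, M = m + 1 := ⟨M - 1, by omega⟩
  have h := Q_full m
  obtain ⟨d, hd⟩ : ∃ d, m = 5 * (m + 1) / 6 + d := ⟨m - 5 * (m + 1) / 6, by omega⟩
  have h1 : Q (m+1) m 0 = Q (m+1) (5 * (m + 1) / 6) 0 * Q (m+1) d (0 + 2 * ((5 * (m + 1) / 6 : ℕ) : ℤ)) := by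
    rw [← Q_add, ← hd]
  have h2 := prod_le_one_aux (m+1) (5 * (m+1)/6) d hM (Or.inr ⟨by omega, by omega⟩)
  have h3 := Q_nonneg (m+1) (5 * (m + 1) / 6) 0
  have : Q (m+1) m 0 ≤ Q (m+1) (5 * (m + 1) / 6) 0 := by rw [h1]; exact mul_le_of_le_one_right h3 h2
  have : (0:ℝ) ≤ m := by positivity
  linarith

lemma peak_max (M k : ℕ) (hk : k < M) : Q M k 0 ≤ Q M (5 * M / 6) 0 := by
  have hM : 0 < M := by omega
  rcases le_total k (5 * M / 6) with h | h
  · rcases le_total M (6 * (k + 1)) with h2 | h2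
    · obtain ⟨d, hd⟩ := Nat.exists_eq_add_of_le h
      rw [hd, Q_add]
      exact le_mul_of_one_le_right (Q_nonneg _ _ _) (prod_ge_one_aux M k d hM h2 (by omega))
    · refine le_trans ?_ (peak_ge_one M hM)
      simpa using prod_le_one_aux M 0 k hM (Or.inl (by omega))
  · obtain ⟨d, hd⟩ := Nat.exists_eq_add_of_le h
    rw [hd, Q_add]
    exact mul_le_of_le_one_right (Q_nonneg _ _ _) (prod_le_one_aux M _ d hM (Or.inr ⟨by omega, by omega⟩))

/-- products near the right end are polynomially bounded -/
lemma Q_end (M k d : ℕ) (hM : k + d + 1 = M) : Q M k 0 ≤ M ^ (d + 1) := by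
  subst hM
  have h := Q_full (k + d)
  rw [Q_add] at h
  have h1 := Q_ge (k + d + 1) d (by omega) (0 + 2 * k) (fun i hi => range_ndvd _ _ (by omega) (by omega))
  have hM' : (0:ℝ) < ((k + d + 1 : ℕ) : ℝ) := by positivity
  have : Q (k+d+1) k 0 * (1 / ((k + d + 1 : ℕ) : ℝ)) ^ d ≤ ((k + d + 1 : ℕ) : ℝ) := by
    calc _ ≤ _ := mul_le_mul_of_nonneg_left h1 (Q_nonneg _ _ _)
      _ = _ := by rw [h]; push_cast; ring
  rw [one_div, inv_pow, ← div_eq_mul_inv, div_le_iff₀ (by positivity)] at this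
  rw [pow_succ]; linarith

/-- the integrand -/
noncomputable def lsin (x : ℝ) : ℝ := Real.log (2 * Real.sin x)

lemma lsin_int (a b : ℝ) : IntervalIntegrable lsin MeasureTheory.volume a b := by
  have : AnalyticOnNhd ℝ (fun x => 2 * Real.sin x) Set.univ := by
    intro x _
    fun_prop
  exact MeromorphicOn.intervalIntegrable_log (this.meromorphicOn.mono_set (Set.subset_univ _))

lemma lsin_pi : ∫ t in (0:ℝ)..Real.pi, lsin t = 0 := by
  have h : ∫ t in (0:ℝ)..Real.pi, lsin t = ∫ t in (0:ℝ)..Real.pi, (Real.log 2 + Real.log (Real.sin t)) := by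
    rw [intervalIntegral.integral_of_le Real.pi_pos.le, intervalIntegral.integral_of_le Real.pi_pos.le,
      MeasureTheory.integral_Ioc_eq_integral_Ioo, MeasureTheory.integral_Ioc_eq_integral_Ioo]
    refine MeasureTheory.setIntegral_congr_fun measurableSet_Ioo fun x hx => ?_
    have := Real.sin_pos_of_mem_Ioo hx
    exact Real.log_mul (by norm_num) this.ne'
  rw [h, intervalIntegral.integral_add (by simp) (by apply intervalIntegrable_log_sin), integral_log_sin_zero_pi]
  simp; ring

/-- primitive -/
noncomputable def F (x : ℝ) : ℝ := ∫ t in (0:ℝ)..x, lsin t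

lemma F_cont : Continuous F := intervalIntegral.continuous_primitive lsin_int 0

lemma F_zero : F 0 = 0 := by simp [F]

lemma F_sub (a b : ℝ) : ∫ t in a..b, lsin t = F b - F a := by
  unfold F
  rw [intervalIntegral.integral_interval_sub_left (lsin_int _ _) (lsin_int _ _)]

lemma F_five : F (5 * Real.pi / 6) = - F (Real.pi / 6) := by
  have h1 := F_sub (5 * Real.pi / 6) Real.pi
  have h2 : F Real.pi = 0 := lsin_pi
  have h3 := intervalIntegral.integral_comp_sub_left (a := 0) (b := Real.pi / 6) lsin Real.pi
  have h4 : (fun x => lsin (Real.pi - x)) = lsin := by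
    funext x; simp [lsin, Real.sin_pi_sub]
  have h5 : ∫ x in (0:ℝ)..Real.pi / 6, lsin (Real.pi - x) = F (Real.pi / 6) := by
    rw [show (fun x => lsin (Real.pi - x)) = lsin from h4]; rfl
  rw [h5, sub_zero, show Real.pi - Real.pi / 6 = 5 * Real.pi / 6 by ring] at h3
  linarith

lemma F_neg : F (Real.pi / 6) < 0 := by
  have hpi := Real.pi_pos
  have : 0 < ∫ t in (0:ℝ)..Real.pi / 6, - lsin t := by
    apply intervalIntegral.intervalIntegral_pos_of_pos_on (lsin_int _ _).neg _ (by positivity)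
    intro x hx
    have h1 : 0 < Real.sin x := Real.sin_pos_of_pos_of_lt_pi hx.1 (by linarith [hx.2])
    have h2 : Real.sin x < Real.sin (Real.pi / 6) :=
      Real.sin_lt_sin_of_lt_of_le_pi_div_two (by linarith [hx.1]) (by linarith) hx.2
    rw [Real.sin_pi_div_six] at h2
    have := Real.log_neg (x := 2 * Real.sin x) (by linarith) (by linarith)
    change 0 < - Real.log (2 * Real.sin x)
    linarith
  rw [intervalIntegral.integral_neg] at this
  unfold F; linarith

lemma Q_reflect (M m k : ℕ) (h : m + k + 1 = M) : Q M m (0 + 2 * k) = Q M m 0 := by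
  unfold Q
  rw [← Finset.prod_range_reflect]
  refine Finset.prod_congr rfl fun i hi => ?_
  have hi' := Finset.mem_range.1 hi
  have e : (2 * (((m - 1 - i : ℕ) : ℤ) + 1) + (0 + 2 * (k:ℤ))) = -(2 * ((i:ℤ) + 1) + 0) + 2 * M * 1 := by omega
  rw [e, U_period M (by omega)]
  unfold U
  push_cast
  rw [show Real.pi * -(2 * ((i:ℝ) + 1) + 0) / (2 * M) = -(Real.pi * (2 * ((i:ℝ) + 1) + 0) / (2 * M)) by ring,
    Real.sin_neg]
  rw [mul_neg, abs_neg]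

lemma log_Q (M m : ℕ) (hm : m < M) : Real.log (Q M m 0) = ∑ i ∈ range m, lsin (Real.pi / M * (1 + i)) := by
  unfold Q
  rw [Real.log_prod]
  · refine Finset.sum_congr rfl fun i hi => ?_
    have hi' := Finset.mem_range.1 hi
    rw [(U_range M (by omega) _ (by omega) (by omega)).1, lsin]
    have hM : (M:ℝ) ≠ 0 := by have : 0 < M := by omega
                              positivity
    congr 3; push_cast; field_simp; ring
  · intro i hi
    have hi' := Finset.mem_range.1 hi
    have hM : 0 < M := by omega
    have := U_lower M hM (2 * ((i:ℤ) + 1) + 0) (range_ndvd _ _ (by omega) (by omega))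
    have : (0:ℝ) < 1 / M := by positivity
    linarith

lemma lsin_mono (M m : ℕ) (hm : 2 * (m + 1) ≤ M) :
    MonotoneOn (fun x : ℝ => lsin (Real.pi / M * x)) (Set.Icc (1:ℝ) (1 + m)) := by
  have hpi := Real.pi_pos
  have hM : (0:ℝ) < M := by have : 0 < M := by omega
                            positivity
  have hm' : 2 * ((m:ℝ) + 1) ≤ M := by exact_mod_cast hm
  intro x hx y hy hxy
  have hx0 : 0 < x := by linarith [hx.1]
  have hy0 : 0 < y := by linarith [hy.1]
  have y2 : Real.pi / M * y ≤ Real.pi / 2 := by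
    rw [div_mul_eq_mul_div, div_le_div_iff₀ hM (by norm_num)]
    nlinarith [hy.2]
  have x1 : 0 < Real.pi / M * x := by positivity
  have xy : Real.pi / M * x ≤ Real.pi / M * y := by gcongr
  have h1 : 0 < Real.sin (Real.pi / M * x) := Real.sin_pos_of_pos_of_lt_pi x1 (by linarith)
  have h2 := Real.sin_le_sin_of_le_of_le_pi_div_two (by linarith) y2 xy
  exact Real.log_le_log (by linarith) (by linarith)

lemma int_scale (M : ℕ) (hM : 0 < M) (a b : ℝ) :
    ∫ x in a..b, lsin (Real.pi / M * x) = M / Real.pi * (F (Real.pi / M * b) - F (Real.pi / M * a)) := by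
  have hM' : (0:ℝ) < M := by positivity
  have hpi := Real.pi_pos
  rw [intervalIntegral.integral_comp_mul_left _ (by positivity), F_sub, smul_eq_mul, inv_div]

lemma log_Q_upper (M m : ℕ) (hm : 2 * (m + 1) ≤ M) :
    Real.log (Q M m 0) / M ≤ 1 / Real.pi * (F (Real.pi / M * (1 + m)) - F (Real.pi / M)) := by
  have hM : 0 < M := by omega
  have hM' : (0:ℝ) < M := by positivity
  have hpi := Real.pi_pos
  rw [log_Q M m (by omega), div_le_iff₀ hM']
  have := (lsin_mono M m hm).sum_le_integral
  rw [int_scale M hM, mul_one] at this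
  refine this.trans (le_of_eq ?_)
  ring

lemma log_Q_lower (M m : ℕ) (hm0 : 0 < m) (hm : 2 * (m + 1) ≤ M) :
    - (Real.log M / M) + 1 / Real.pi * (F (Real.pi / M * m) - F (Real.pi / M)) ≤ Real.log (Q M m 0) / M := by
  have hM : 0 < M := by omega
  have hM' : (0:ℝ) < M := by positivity
  have hpi := Real.pi_pos
  obtain ⟨p, rfl⟩ : ∃ p, m = p + 1 := ⟨m - 1, by omega⟩
  rw [log_Q M _ (by omega), le_div_iff₀ hM', Finset.sum_range_succ']
  have := ((lsin_mono M p (by omega))).integral_le_sum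
  rw [int_scale M hM, mul_one] at this
  have h1 : - Real.log M ≤ lsin (Real.pi / M * (1 + ((0:ℕ):ℝ))) := by
    have h := U_lower M hM 2 (range_ndvd _ _ (by omega) (by omega))
    have h2 := (U_range M hM 2 (by omega) (by omega)).1
    have e : lsin (Real.pi / M * (1 + ((0:ℕ):ℝ))) = Real.log (U M 2) := by
      rw [h2, lsin]; congr 3; push_cast; field_simp; simp
    rw [e, ← Real.log_inv, ← one_div]
    exact Real.log_le_log (by positivity) h
  have e2 : (-(Real.log M / M) + 1 / Real.pi * (F (Real.pi / M * ((p + 1 : ℕ):ℝ)) - F (Real.pi / M))) * M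
     = - Real.log M + M / Real.pi * (F (Real.pi / M * (1 + p)) - F (Real.pi / M)) := by
    push_cast; rw [add_comm (p:ℝ) 1]; field_simp
  rw [e2]
  linarith

lemma tail_lim : Tendsto (fun M : ℕ => Real.log (Q M (M - 1 - 5 * M / 6) 0) / M) atTop
    (nhds (1 / Real.pi * F (Real.pi / 6))) := by
  have hinv : Tendsto (fun M : ℕ => 1 / (M:ℝ)) atTop (nhds 0) := tendsto_one_div_atTop_nhds_zero_nat
  have hlog : Tendsto (fun M : ℕ => Real.log M / (M:ℝ)) atTop (nhds 0) :=
    (Real.isLittleO_log_id_atTop.tendsto_div_nhds_zero).comp tendsto_natCast_atTop_atTop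
  have hm : Tendsto (fun M : ℕ => ((M - 1 - 5 * M / 6 : ℕ) : ℝ) / M) atTop (nhds (1 / 6)) := by
    have l : Tendsto (fun M : ℕ => 1 / 6 - 1 / (M:ℝ)) atTop (nhds (1 / 6)) := by
      simpa using tendsto_const_nhds.sub hinv
    refine tendsto_of_tendsto_of_tendsto_of_le_of_le' l tendsto_const_nhds ?_ ?_
    · filter_upwards [eventually_ge_atTop 12] with M hM
      have hM' : (0:ℝ) < M := by have : 0 < M := by omega
                                 positivity
      rw [le_div_iff₀ hM', sub_mul, one_div_mul_cancel hM'.ne']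
      have : M ≤ 6 * (M - 1 - 5 * M / 6) + 6 := by omega
      have : (M:ℝ) ≤ 6 * ((M - 1 - 5 * M / 6 : ℕ) : ℝ) + 6 := by exact_mod_cast this
      linarith
    · filter_upwards [eventually_ge_atTop 12] with M hM
      have hM' : (0:ℝ) < M := by have : 0 < M := by omega
                                 positivity
      rw [div_le_iff₀ hM']
      have : 6 * (M - 1 - 5 * M / 6) ≤ M := by omega
      have : 6 * ((M - 1 - 5 * M / 6 : ℕ) : ℝ) ≤ (M:ℝ) := by exact_mod_cast this
      linarith
  have hFm : Tendsto (fun M : ℕ => F (Real.pi / M * ((M - 1 - 5 * M / 6 : ℕ) : ℝ))) atTop (nhds (F (Real.pi / 6))) := by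
    refine (F_cont.tendsto _).comp ?_
    have := hm.const_mul Real.pi
    rw [show Real.pi * (1 / 6) = Real.pi / 6 by ring] at this
    refine this.congr fun M => by ring
  have hFm1 : Tendsto (fun M : ℕ => F (Real.pi / M * (1 + ((M - 1 - 5 * M / 6 : ℕ) : ℝ)))) atTop (nhds (F (Real.pi / 6))) := by
    refine (F_cont.tendsto _).comp ?_
    have := (hinv.add hm).const_mul Real.pi
    rw [show Real.pi * (0 + 1 / 6) = Real.pi / 6 by ring] at this
    refine this.congr fun M => by ring
  have hF0 : Tendsto (fun M : ℕ => F (Real.pi / M)) atTop (nhds 0) := by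
    rw [← F_zero]
    refine (F_cont.tendsto _).comp ?_
    have := hinv.const_mul Real.pi
    rw [mul_zero] at this
    refine this.congr fun M => by ring
  have lo := hlog.neg.add ((hFm.sub hF0).const_mul (1 / Real.pi))
  have up := (hFm1.sub hF0).const_mul (1 / Real.pi)
  rw [neg_zero, zero_add, sub_zero] at lo
  rw [sub_zero] at up
  refine tendsto_of_tendsto_of_tendsto_of_le_of_le' lo up ?_ ?_
  · filter_upwards [eventually_ge_atTop 12] with M hM
    exact log_Q_lower M _ (by omega) (by omega)
  · filter_upwards [eventually_ge_atTop 12] with M hM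
    exact log_Q_upper M _ (by omega)

lemma peak_lim : Tendsto (fun M : ℕ => Real.log (Q M (5 * M / 6) 0) / M) atTop
    (nhds (1 / Real.pi * F (5 * Real.pi / 6))) := by
  have hlog : Tendsto (fun M : ℕ => Real.log M / (M:ℝ)) atTop (nhds 0) :=
    (Real.isLittleO_log_id_atTop.tendsto_div_nhds_zero).comp tendsto_natCast_atTop_atTop
  have := hlog.sub tail_lim
  rw [F_five, mul_neg, ← zero_sub]
  refine this.congr' ?_
  filter_upwards [eventually_ge_atTop 12] with M hM
  obtain ⟨m, rfl⟩ : ∃ m, M = m + 1 := ⟨M - 1, by omega⟩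
  have hf := Q_full m
  set d := m + 1 - 1 - 5 * (m + 1) / 6 with hd
  have h1 : Q (m+1) m 0 = Q (m+1) (5 * (m + 1) / 6) 0 * Q (m+1) d (0 + 2 * ((5 * (m + 1) / 6 : ℕ) : ℤ)) := by
    rw [← Q_add]; congr 1; omega
  rw [Q_reflect (m+1) d _ (by omega), hf] at h1
  have hp := peak_ge_one (m+1) (by omega)
  have hm0 : (0:ℝ) < m + 1 := by positivity
  have hq : Q (m+1) d 0 ≠ 0 := by
    intro h0; rw [h0] at h1; linarith
  rw [← sub_div]
  congr 1
  push_cast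
  rw [h1, Real.log_mul (by linarith) hq]; ring

/-- partial products -/
noncomputable def p (n b : ℤ) (M k : ℕ) : ℝ := ∏ i ∈ range k, g n b M (i + 1)

lemma S_eq_p (n b : ℤ) (N M : ℕ) (hb : 1 ≤ b) (hMM : (M:ℤ) = N + b) :
    S n b N = ((∑ k ∈ range (N + 1), p n b M k : ℝ) : ℂ) := by
  rw [S_eq n b N M hb hMM]
  congr 1
  have hp : ∀ k, ∏ i ∈ Finset.Icc 1 k, g n b M i = p n b M k := by
    intro k
    have : Finset.Icc 1 k = Finset.Ico 1 (k + 1) := by ext; simp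
    rw [this, Finset.prod_Ico_eq_prod_range, p]
    refine Finset.prod_congr (by simp) fun i _ => by rw [add_comm]
  have : Finset.Icc 1 N = Finset.Ico 1 (N + 1) := by ext; simp
  rw [this, Finset.sum_congr rfl (fun k _ => hp k), Finset.sum_Ico_eq_sum_range, Finset.sum_range_succ',
    add_comm]
  congr 1
  · refine Finset.sum_congr (by simp) fun i _ => by rw [add_comm]

lemma abs_p (n b : ℤ) (M k : ℕ) : |p n b M k| =
    Q M k (2 * b - 2) / Q M k 0 * Q M k (b + n - 3) * Q M k (b + 1 - n) := by
  unfold p Q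
  rw [Finset.abs_prod, ← Finset.prod_div_distrib, ← Finset.prod_mul_distrib, ← Finset.prod_mul_distrib]
  refine Finset.prod_congr rfl fun i _ => ?_
  unfold g U
  rw [abs_mul, abs_mul, abs_div]
  push_cast
  rfl

lemma p_up (n b : ℤ) (hn : 2 ≤ n) (hb : 1 ≤ b) (h : Odd (b + 1 - n) ∨ 0 ≤ b + 1 - n) :
    ∃ C M0 : ℕ, ∀ M ≥ M0, ∀ k < M, |p n b M k| ≤ (2 * M) ^ C * (Q M k 0) ^ 2 := by
  obtain ⟨C0, M0, h0⟩ := cmp_up (2 * b - 2) (Or.inr (by omega))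
  obtain ⟨C1, M1, h1⟩ := cmp_up (b + n - 3) (Or.inr (by omega))
  obtain ⟨C2, M2, h2⟩ := cmp_up (b + 1 - n) h
  refine ⟨C0 + C1 + C2, M0 + M1 + M2, fun M hM k hk => ?_⟩
  rw [abs_p]
  have q := Q_nonneg M k
  have a0 : Q M k (2 * b - 2) / Q M k 0 ≤ (2 * M) ^ C0 :=
    div_le_of_le_mul₀ (q _) (by positivity) (h0 M (by omega) k hk)
  have a00 : 0 ≤ Q M k (2 * b - 2) / Q M k 0 := div_nonneg (q _) (q _)
  calc _ ≤ (2 * M) ^ C0 * ((2 * M) ^ C1 * Q M k 0) * ((2 * M) ^ C2 * Q M k 0) := by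
        gcongr
        · exact q _
        · have := q 0; positivity
        · exact q _
        · exact h1 M (by omega) k hk
        · exact h2 M (by omega) k hk
    _ = _ := by ring

lemma p_down (n b : ℤ) (hn : 2 ≤ n) (hb : 1 ≤ b) (h : Odd (b + 1 - n) ∨ 0 ≤ b + 1 - n) :
    ∃ C M0 : ℕ, ∀ M ≥ M0, (Q M (5 * M / 6) 0) ^ 2 ≤ (2 * M) ^ C * |p n b M (5 * M / 6)| := by
  obtain ⟨C0, M0, h0⟩ := cmp_down (2 * b - 2) (Or.inr (by omega))
  obtain ⟨C1, M1, h1⟩ := cmp_down (b + n - 3) (Or.inr (by omega))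
  obtain ⟨C2, M2, h2⟩ := cmp_down (b + 1 - n) h
  refine ⟨C0 + C1 + C2, M0 + M1 + M2 + 1, fun M hM => ?_⟩
  rw [abs_p]
  set k := 5 * M / 6
  have q := Q_nonneg M k
  have q1 : 1 ≤ Q M k 0 := peak_ge_one M (by omega)
  have a0 : 1 ≤ (2 * M) ^ C0 * (Q M k (2 * b - 2) / Q M k 0) := by
    rw [← mul_div_assoc, le_div_iff₀ (by linarith), one_mul]
    exact h0 M (by omega)
  calc (Q M k 0) ^ 2 = 1 * Q M k 0 * Q M k 0 := by ring
    _ ≤ ((2 * M) ^ C0 * (Q M k (2 * b - 2) / Q M k 0)) * ((2 * M) ^ C1 * Q M k (b + n - 3)) *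
          ((2 * M) ^ C2 * Q M k (b + 1 - n)) := by
        have h1' := h1 M (by omega)
        have h2' := h2 M (by omega)
        have z1 : 0 ≤ (2 * (M:ℝ)) ^ C1 * Q M k (b + n - 3) := mul_nonneg (by positivity) (q _)
        refine mul_le_mul (mul_le_mul a0 h1' (q _) (by linarith)) h2' (q _) (mul_nonneg (by linarith) z1)
    _ = _ := by ring

lemma g_nonneg (n b : ℤ) (hn : 2 ≤ n) (hb : 1 ≤ b) (M i K : ℕ) (hK : (K:ℤ) = n + b) (h0 : K < i)
    (h1 : i + K ≤ M) : 0 ≤ g n b M i := by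
  have hM : 0 < M := by omega
  have a := (U_range M hM (2 * i + (2 * b - 2)) (by omega) (by omega)).2
  have a1 := (U_range M hM (2 * i + 0) (by omega) (by omega)).2
  have a2 := (U_range M hM (2 * i + (b + n - 3)) (by omega) (by omega)).2
  have a3 := (U_range M hM (2 * i + (b + 1 - n)) (by omega) (by omega)).2
  unfold g
  exact mul_nonneg (mul_nonneg (div_nonneg (by linarith) (by linarith)) (by linarith)) (by linarith)

lemma p_sign (n b : ℤ) (hn : 2 ≤ n) (hb : 1 ≤ b) (M K : ℕ) (hK : (K:ℤ) = n + b) :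
    ∃ σ : ℝ, |σ| = 1 ∧ ∀ k, K ≤ k → k + K ≤ M → σ * p n b M k = |p n b M k| := by
  have key : ∀ k, K ≤ k → k + K ≤ M → ∃ r, 0 ≤ r ∧ p n b M k = p n b M K * r := by
    intro k h0 h1
    obtain ⟨d, rfl⟩ := Nat.exists_eq_add_of_le h0
    refine ⟨∏ i ∈ range d, g n b M (K + i + 1), ?_, ?_⟩
    · refine Finset.prod_nonneg fun i hi => ?_
      have := Finset.mem_range.1 hi
      exact g_nonneg n b hn hb M _ K hK (by omega) (by omega)
    · unfold p; rw [Finset.prod_range_add]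
  rcases le_total 0 (p n b M K) with h | h
  · refine ⟨1, by simp, fun k h0 h1 => ?_⟩
    obtain ⟨r, hr, e⟩ := key k h0 h1
    rw [e, one_mul, abs_of_nonneg (mul_nonneg h hr)]
  · refine ⟨-1, by simp, fun k h0 h1 => ?_⟩
    obtain ⟨r, hr, e⟩ := key k h0 h1
    rw [e, abs_of_nonpos (mul_nonpos_of_nonpos_of_nonneg h hr)]; ring

lemma S_bounds (n b : ℤ) (hn : 2 ≤ n) (hb : 1 ≤ b) (h : Odd (b + 1 - n) ∨ 0 ≤ b + 1 - n) :
    ∃ C M0 : ℕ, ∀ N M : ℕ, (M:ℤ) = N + b → M ≥ M0 →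
      ‖S n b N‖ ≤ (2 * M) ^ C * (Q M (5 * M / 6) 0) ^ 2 ∧
      (Q M (5 * M / 6) 0) ^ 2 ≤ (2 * M) ^ C * (‖S n b N‖ + (2 * M) ^ C) := by
  obtain ⟨C1, M1, h1⟩ := p_up n b hn hb h
  obtain ⟨C2, M2, h2⟩ := p_down n b hn hb h
  obtain ⟨K, hK⟩ := Int.eq_ofNat_of_zero_le (show 0 ≤ n + b by omega)
  refine ⟨C1 + 2 * K + 1 + C2, M1 + M2 + 12 * (K + 1), fun N M hMM hM => ?_⟩
  have hM1 : (1:ℝ) ≤ 2 * M := by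
    have : 1 ≤ 2 * M := by omega
    exact_mod_cast this
  have hM0 : (0:ℝ) ≤ 2 * M := by linarith
  have hN : ((N:ℝ) + 1) ≤ 2 * M := by
    have : N + 1 ≤ 2 * M := by omega
    exact_mod_cast this
  have hS : ‖S n b N‖ = |∑ k ∈ range (N + 1), p n b M k| := by
    rw [S_eq_p n b N M hb hMM, Complex.norm_real, Real.norm_eq_abs]
  set A := Q M (5 * M / 6) 0 with hA
  have hA1 : 1 ≤ A := peak_ge_one M (by omega)
  have pw : ∀ a c : ℕ, a ≤ c → (2 * (M:ℝ)) ^ a ≤ (2 * M) ^ c := fun a c hac => pow_le_pow_right₀ hM1 hac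
  constructor
  · rw [hS]
    calc _ ≤ ∑ k ∈ range (N + 1), |p n b M k| := Finset.abs_sum_le_sum_abs _ _
      _ ≤ ∑ k ∈ range (N + 1), (2 * M) ^ C1 * A ^ 2 := by
        refine Finset.sum_le_sum fun k hk => ?_
        have hk' := Finset.mem_range.1 hk
        refine (h1 M (by omega) k (by omega)).trans ?_
        have := peak_max M k (by omega)
        have := Q_nonneg M k 0
        gcongr
      _ = (N + 1) * ((2 * M) ^ C1 * A ^ 2) := by simp
      _ ≤ (2 * M) * ((2 * M) ^ C1 * A ^ 2) := by gcongr
      _ = (2 * M) ^ (C1 + 1) * A ^ 2 := by ring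
      _ ≤ _ := by
        apply mul_le_mul_of_nonneg_right _ (by positivity)
        exact pw _ _ (by omega)
  · obtain ⟨σ, hσ, hs⟩ := p_sign n b hn hb M K hK.symm
    set B : ℝ := (2 * M) ^ (C1 + 2 * K) with hB
    have hB0 : 0 ≤ B := by positivity
    have each : ∀ k ∈ range (N + 1),
        (if k = 5 * M / 6 then |p n b M (5 * M / 6)| else 0) - B ≤ σ * p n b M k := by
      intro k hk
      have hk' := Finset.mem_range.1 hk
      by_cases hmid : K ≤ k ∧ k + K ≤ M
      · rw [hs k hmid.1 hmid.2]
        split_ifs with hh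
        · subst hh; linarith
        · have := abs_nonneg (p n b M k); linarith
      · have hne : k ≠ 5 * M / 6 := by omega
        rw [if_neg hne]
        have q0 := Q_nonneg M k 0
        have hq : Q M k 0 ≤ (2 * M) ^ K := by
          by_cases hlow : k < K
          · calc _ ≤ _ := Q_le M k 0
              _ ≤ (2:ℝ) ^ K := pow_le_pow_right₀ (by norm_num) hlow.le
              _ ≤ _ := by
                apply pow_le_pow_left₀ (by norm_num)
                have : 2 ≤ 2 * M := by omega
                exact_mod_cast this
          · have := Q_end M k (M - 1 - k) (by omega)
            calc _ ≤ _ := this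
              _ ≤ (2 * (M:ℝ)) ^ (M - 1 - k + 1) := by
                apply pow_le_pow_left₀ (by positivity)
                linarith
              _ ≤ _ := pw _ _ (by omega)
        have hp : |p n b M k| ≤ B := by
          calc _ ≤ _ := h1 M (by omega) k (by omega)
            _ ≤ (2 * M) ^ C1 * ((2 * M) ^ K) ^ 2 := by gcongr
            _ = B := by rw [hB]; ring
        have : |σ * p n b M k| ≤ B := by rw [abs_mul, hσ, one_mul]; exact hp
        have := (abs_le.1 this).1
        linarith
    have hsum := Finset.sum_le_sum each
    rw [Finset.sum_sub_distrib, Finset.sum_ite_eq', if_pos (Finset.mem_range.2 (by omega)), ← Finset.mul_sum] at hsum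
    simp only [sum_const, card_range, nsmul_eq_mul] at hsum
    push_cast at hsum
    have hle : σ * ∑ k ∈ range (N + 1), p n b M k ≤ ‖S n b N‖ := by
      rw [hS]
      refine (le_abs_self _).trans ?_
      rw [abs_mul, hσ, one_mul]
    have hNB : ((N:ℝ) + 1) * B ≤ (2 * M) ^ (C1 + 2 * K + 1) := by
      calc _ ≤ (2 * M) * B := by gcongr
        _ = _ := by rw [hB]; ring
    have hpk : |p n b M (5 * M / 6)| ≤ ‖S n b N‖ + (2 * M) ^ (C1 + 2 * K + 1) := by linarith
    have hn0 := norm_nonneg (S n b N)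
    calc A ^ 2 ≤ _ := h2 M (by omega)
      _ ≤ (2 * M) ^ C2 * (‖S n b N‖ + (2 * M) ^ (C1 + 2 * K + 1)) := by gcongr
      _ ≤ _ := by
        apply mul_le_mul (pw _ _ (by omega)) _ (by positivity) (by positivity)
        have := pw (C1 + 2 * K + 1) (C1 + 2 * K + 1 + C2) (by omega)
        linarith

theorem volume_conjecture_figure_eight (n b : ℤ) (hn : 2 ≤ n) (hb : 1 ≤ b)
    (h : ¬ ∃ m : ℤ, 0 < m ∧ n - 1 - b = 2 * m) :
    Filter.Tendsto
      (fun N : ℕ => 2 * Real.pi / ((N : ℝ) + 1) * Real.log ‖S n b N‖)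
      Filter.atTop
      (nhds (4 * ∫ t in (0:ℝ)..(5 * Real.pi / 6), Real.log (2 * Real.sin t))) := by
  change Tendsto _ _ (nhds (4 * F (5 * Real.pi / 6)))
  have hpi := Real.pi_pos
  have hcond : Odd (b + 1 - n) ∨ 0 ≤ b + 1 - n := by
    rcases Int.even_or_odd' (b + 1 - n) with ⟨c, hc | hc⟩
    · right
      by_contra hneg
      exact h ⟨-c, by omega, by omega⟩
    · left; exact ⟨c, hc⟩
  obtain ⟨C, M0, hSb⟩ := S_bounds n b hn hb hcond
  obtain ⟨β, hβ⟩ := Int.eq_ofNat_of_zero_le (show 0 ≤ b by omega)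
  have hsh : Tendsto (fun N : ℕ => N + β) atTop atTop := tendsto_add_atTop_nat β
  set L := 1 / Real.pi * F (5 * Real.pi / 6) with hL
  have hLpos : 0 < L := by
    have := F_neg
    rw [hL, F_five]
    apply mul_pos (by positivity) (by linarith)
  -- logarithm of the peak squared
  have hA : Tendsto (fun M : ℕ => Real.log ((Q M (5 * M / 6) 0) ^ 2) / M) atTop (nhds (2 * L)) := by
    refine (peak_lim.const_mul 2).congr fun M => ?_
    rw [Real.log_pow]; push_cast; ring
  have hinv : Tendsto (fun M : ℕ => 1 / (M:ℝ)) atTop (nhds 0) := tendsto_one_div_atTop_nhds_zero_nat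
  have hlog : Tendsto (fun M : ℕ => Real.log (2 * M) / (M:ℝ)) atTop (nhds 0) := by
    have h1 : Tendsto (fun M : ℕ => Real.log M / (M:ℝ)) atTop (nhds 0) :=
      (Real.isLittleO_log_id_atTop.tendsto_div_nhds_zero).comp tendsto_natCast_atTop_atTop
    have := (hinv.const_mul (Real.log 2)).add h1
    rw [mul_zero, zero_add] at this
    refine this.congr' ?_
    filter_upwards [eventually_gt_atTop 0] with M hM
    have : (M:ℝ) ≠ 0 := by positivity
    rw [Real.log_mul (by norm_num) this]; ring
  have hlo := (hA.sub (hlog.const_mul (C:ℝ))).sub (hinv.const_mul (Real.log 2))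
  have hup := hA.add (hlog.const_mul (C:ℝ))
  have hbig := (hA.sub (hlog.const_mul (2 * C:ℝ))).sub (hinv.const_mul (Real.log 2))
  simp only [mul_zero, sub_zero, add_zero] at hlo hup hbig
  have hev : ∀ᶠ M : ℕ in atTop, 2 * (2 * (M:ℝ)) ^ (2 * C) ≤ (Q M (5 * M / 6) 0) ^ 2 := by
    filter_upwards [hbig.eventually (lt_mem_nhds (show 0 < 2 * L by linarith)), eventually_gt_atTop 0] with M hM hM0
    have hM' : (0:ℝ) < M := by positivity
    have hp := peak_ge_one M hM0
    rw [← Real.log_le_log_iff (by positivity) (by positivity), Real.log_mul (by norm_num) (by positivity),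
      Real.log_pow (2 * (M:ℝ))]
    have e : Real.log (Q M (5 * M / 6) 0 ^ 2) / M - 2 * C * (Real.log (2 * M) / M) - Real.log 2 * (1 / M)
      = (Real.log (Q M (5 * M / 6) 0 ^ 2) - 2 * C * Real.log (2 * M) - Real.log 2) / M := by
      field_simp
    rw [e] at hM
    have := (div_pos_iff_of_pos_right hM').1 hM
    push_cast
    linarith
  have main : Tendsto (fun N : ℕ => Real.log ‖S n b N‖ / ((N + β : ℕ) : ℝ)) atTop (nhds (2 * L)) := by
    have ev2 : ∀ᶠ N : ℕ in atTop, M0 + 1 ≤ N + β ∧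
        2 * (2 * ((N + β : ℕ):ℝ)) ^ (2 * C) ≤ (Q (N + β) (5 * (N + β) / 6) 0) ^ 2 :=
      (hsh.eventually (eventually_ge_atTop (M0 + 1))).and (hsh.eventually hev)
    have both : ∀ᶠ N : ℕ in atTop, 
        (Real.log ((Q (N + β) (5 * (N + β) / 6) 0) ^ 2) / ((N + β : ℕ) : ℝ)
          - C * (Real.log (2 * ((N + β : ℕ) : ℝ)) / ((N + β : ℕ) : ℝ)) - Real.log 2 * (1 / ((N + β : ℕ) : ℝ))
          ≤ Real.log ‖S n b N‖ / ((N + β : ℕ) : ℝ)) ∧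
        (Real.log ‖S n b N‖ / ((N + β : ℕ) : ℝ) ≤ Real.log ((Q (N + β) (5 * (N + β) / 6) 0) ^ 2) / ((N + β : ℕ) : ℝ)
          + C * (Real.log (2 * ((N + β : ℕ) : ℝ)) / ((N + β : ℕ) : ℝ))) := by
      filter_upwards [ev2] with N hN
      obtain ⟨hN1, hN2⟩ := hN
      obtain ⟨s1, s2⟩ := hSb N (N + β) (by rw [hβ]; push_cast; rfl) (by omega)
      have hp := peak_ge_one (N + β) (by omega)
      generalize N + β = M at *
      have hM' : (0:ℝ) < M := by have : 0 < M := by omega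
                                 positivity
      set A := (Q M (5 * M / 6) 0) ^ 2 with hAdef
      have hA0 : 0 < A := by positivity
      set s := ‖S n b N‖ with hs
      have hP : (0:ℝ) < (2 * M) ^ C := by positivity
      have hhalf : A ≤ 2 * ((2 * M) ^ C * s) := by
        have e : (2 * (M:ℝ)) ^ (2 * C) = (2 * M) ^ C * (2 * M) ^ C := by rw [two_mul C, pow_add]
        rw [e] at hN2
        linarith
      have hs0 : 0 < s := by
        by_contra hneg
        have : (2 * (M:ℝ)) ^ C * s ≤ 0 := mul_nonpos_of_nonneg_of_nonpos hP.le (by linarith)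
        linarith
      have l1 := Real.log_le_log hA0 hhalf
      rw [Real.log_mul (by norm_num) (by positivity), Real.log_mul hP.ne' hs0.ne', Real.log_pow (2 * (M:ℝ))] at l1
      have l2 := Real.log_le_log hs0 s1
      rw [Real.log_mul hP.ne' hA0.ne', Real.log_pow (2 * (M:ℝ))] at l2
      constructor
      · have e : Real.log A / M - C * (Real.log (2 * M) / M) - Real.log 2 * (1 / M)
          = (Real.log A - C * Real.log (2 * M) - Real.log 2) / M := by ring
        rw [e]
        gcongr
        linarith
      · have e : Real.log A / M + C * (Real.log (2 * M) / M)
          = (Real.log A + C * Real.log (2 * M)) / M := by ring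
        rw [e]
        gcongr
        linarith
    exact tendsto_of_tendsto_of_tendsto_of_le_of_le' (hlo.comp hsh) (hup.comp hsh)
      (both.mono fun N hN => hN.1) (both.mono fun N hN => hN.2)
  have hratio : Tendsto (fun N : ℕ => ((N + β : ℕ) : ℝ) / ((N:ℝ) + 1)) atTop (nhds 1) := by
    have h1 := (tendsto_one_div_add_atTop_nhds_zero_nat (𝕜 := ℝ)).const_mul ((β:ℝ) - 1)
    have := h1.const_add 1
    rw [mul_zero, add_zero] at this
    refine this.congr fun N => ?_
    have : (N:ℝ) + 1 ≠ 0 := by positivity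
    push_cast; field_simp; ring
  have fin := ((hratio.mul main).const_mul (2 * Real.pi))
  have e : 2 * Real.pi * (1 * (2 * L)) = 4 * F (5 * Real.pi / 6) := by
    rw [hL]; field_simp; ring
  rw [e] at fin
  refine fin.congr fun N => ?_
  have hM' : (((N + β : ℕ)) : ℝ) ≠ 0 := by
    have : 0 < N + β := by omega
    positivity
  have : (N:ℝ) + 1 ≠ 0 := by positivity
  field_simp
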